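/- Let A be a commutative noetherian ring, x = x_1,…,x_t a sequence of elements of A generating the ideal 𝔞 = (x), M an A-module, and n a non-negative integer. Then Ext_A^i(A/𝔞, M) is finitely generated for all i ≤ n if and only if the Koszul cohomology module H^i(x, M) is finitely generated for all i ≤ n. -/

import Mathlib

open CategoryTheory Limits

noncomputable section

variable {A : Type} [CommRing A]

/-- The `i`-th term of the Koszul cochain complex `Hom_A(K_•(x), M)`. -/
abbrev KoszulCochain {t : ℕ} (x : Fin t → A) (M : Type) [AddCommGroup M] [Module A M]
    (i : ℕ) : Type :=
  {s : Finset (Fin t) // s.card = i} → M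

/-- The Koszul cochain differential. -/
def koszulD {t : ℕ} (x : Fin t → A) (M : Type) [AddCommGroup M] [Module A M] (i : ℕ) :
    KoszulCochain x M i →ₗ[A] KoszulCochain x M (i + 1) :=
  LinearMap.pi fun s => ∑ j ∈ s.1.attach,
    (((-1 : A) ^ ((s.1.filter (fun k => k < j.1)).card)) * x j.1) •
      (LinearMap.proj
        (⟨s.1.erase j.1, by simp [Finset.card_erase_of_mem j.2, s.2]⟩ :
          {s : Finset (Fin t) // s.card = i}) :
        KoszulCochain x M i →ₗ[A] M)

/-- The boundaries in degree `i` of the Koszul cochain complex. -/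
def koszulBoundary {t : ℕ} (x : Fin t → A) (M : Type) [AddCommGroup M] [Module A M] :
    (i : ℕ) → Submodule A (KoszulCochain x M i)
  | 0 => ⊥
  | j + 1 => LinearMap.range (koszulD x M j)

/-- The `i`-th Koszul cohomology `H^i(x, M)` of `M` with respect to `x`. -/
abbrev KoszulCohomology {t : ℕ} (x : Fin t → A) (M : Type) [AddCommGroup M] [Module A M]
    (i : ℕ) : Type :=
  LinearMap.ker (koszulD x M i) ⧸
    (koszulBoundary x M i).comap (LinearMap.ker (koszulD x M i)).subtype

/-- `Ext_A^i(A/𝔞, M)` as an `A`-module. -/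
abbrev extQuot (𝔞 : Ideal A) (M : Type) [AddCommGroup M] [Module A M] (i : ℕ) : Type :=
  ↥(((_root_.Ext A (ModuleCat A) i).obj
    (Opposite.op (ModuleCat.of A (A ⧸ 𝔞)))).obj (ModuleCat.of A M))

section GeneralPart

open CategoryTheory.Abelian

variable (M : Type) [AddCommGroup M] [Module A M]

variable (A) in
/-- Finiteness of the `i`-th Ext module. -/
def EF (N : Type) [AddCommGroup N] [Module A N] (i : ℕ) : Prop :=
  Module.Finite A (Abelian.Ext (ModuleCat.of A N) (ModuleCat.of A M) i)

section LES

variable {N₁ N₂ N₃ : Type} [AddCommGroup N₁] [Module A N₁] [AddCommGroup N₂] [Module A N₂]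
  [AddCommGroup N₃] [Module A N₃]

theorem finite_mid [IsNoetherianRing A] {X Y Z : Type} [AddCommGroup X] [Module A X]
    [AddCommGroup Y] [Module A Y]
    [AddCommGroup Z] [Module A Z] (f : X →ₗ[A] Y) (g : Y →ₗ[A] Z)
    (h : ∀ y, g y = 0 → ∃ x, f x = y) (hX : Module.Finite A X) (hZ : Module.Finite A Z) :
    Module.Finite A Y := by
  constructor
  apply Submodule.fg_of_fg_map_of_fg_inf_ker g
  · exact Submodule.FG.of_le hZ.fg_top le_top
  · refine Submodule.FG.of_le (T := LinearMap.range f) ?_ ?_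
    · rw [LinearMap.range_eq_map]; exact hX.fg_top.map f
    · rintro y ⟨-, hy⟩
      exact h y hy

theorem ef_mid [IsNoetherianRing A] (f : N₁ →ₗ[A] N₂) (g : N₂ →ₗ[A] N₃)
    (hf : Function.Injective f) (hg : Function.Surjective g) (hfg : Function.Exact f g) (i : ℕ)
    (h3 : EF A M N₃ i) (h1 : EF A M N₁ i) : EF A M N₂ i := by
  have hS := ModuleCat.shortComplex_shortExact
    (ModuleCat.shortComplexOfCompEqZero f g hfg.linearMap_comp_eq_zero) hfg hf hg
  exact finite_mid
    ((Ext.mk₀ (ModuleCat.ofHom g)).precompOfLinear A (ModuleCat.of A M) (zero_add i))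
    ((Ext.mk₀ (ModuleCat.ofHom f)).precompOfLinear A (ModuleCat.of A M) (zero_add i))
    (fun y hy => Ext.contravariant_sequence_exact₂ hS _ y hy) h3 h1

theorem ef_left [IsNoetherianRing A] (f : N₁ →ₗ[A] N₂) (g : N₂ →ₗ[A] N₃)
    (hf : Function.Injective f) (hg : Function.Surjective g) (hfg : Function.Exact f g) (i : ℕ)
    (h2 : EF A M N₂ i) (h3 : EF A M N₃ (i + 1)) : EF A M N₁ i := by
  have hS := ModuleCat.shortComplex_shortExact
    (ModuleCat.shortComplexOfCompEqZero f g hfg.linearMap_comp_eq_zero) hfg hf hg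
  exact finite_mid
    ((Ext.mk₀ (ModuleCat.ofHom f)).precompOfLinear A (ModuleCat.of A M) (zero_add i))
    (hS.extClass.precompOfLinear A (ModuleCat.of A M) (add_comm 1 i))
    (fun y hy => Ext.contravariant_sequence_exact₁ hS _ y (add_comm 1 i) hy) h2 h3

theorem ef_right [IsNoetherianRing A] (f : N₁ →ₗ[A] N₂) (g : N₂ →ₗ[A] N₃)
    (hf : Function.Injective f) (hg : Function.Surjective g) (hfg : Function.Exact f g) (i : ℕ)
    (h1 : EF A M N₁ i) (h2 : EF A M N₂ (i + 1)) : EF A M N₃ (i + 1) := by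
  have hS := ModuleCat.shortComplex_shortExact
    (ModuleCat.shortComplexOfCompEqZero f g hfg.linearMap_comp_eq_zero) hfg hf hg
  exact finite_mid
    (hS.extClass.precompOfLinear A (ModuleCat.of A M) (add_comm 1 i))
    ((Ext.mk₀ (ModuleCat.ofHom g)).precompOfLinear A (ModuleCat.of A M) (zero_add (i + 1)))
    (fun y hy => Ext.contravariant_sequence_exact₃ hS _ y hy (add_comm 1 i)) h1 h2

theorem ef_proj (P : Type) [AddCommGroup P] [Module A P] [Module.Projective A P] (i : ℕ) :
    EF A M P (i + 1) := by
  have : Projective (ModuleCat.of A P) :=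
    (IsProjective.iff_projective P).1 inferInstance
  have := Ext.subsingleton_of_projective (ModuleCat.of A P) (ModuleCat.of A M) i
  unfold EF
  infer_instance

theorem ef_zero_iff (N : Type) [AddCommGroup N] [Module A N] :
    EF A M N 0 ↔ Module.Finite A (N →ₗ[A] M) :=
  Module.Finite.equiv_iff (Ext.linearEquiv₀.trans ModuleCat.homLinearEquiv)

theorem ef_equiv (e : N₁ ≃ₗ[A] N₂) (i : ℕ) (h : EF A M N₁ i) : EF A M N₂ i := by
  unfold EF at *
  refine Module.Finite.of_surjective
    ((Ext.mk₀ (ModuleCat.ofHom e.symm.toLinearMap)).precompOfLinear A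
      (ModuleCat.of A M) (zero_add i)) ?_
  intro y
  refine ⟨(Ext.mk₀ (ModuleCat.ofHom e.toLinearMap)).comp y (zero_add i), ?_⟩
  change (Ext.mk₀ _).comp ((Ext.mk₀ _).comp y (zero_add i)) (zero_add i) = y
  rw [Ext.mk₀_comp_mk₀_assoc, ← ModuleCat.ofHom_comp]
  simp

theorem ef_subsingleton (N : Type) [AddCommGroup N] [Module A N] [Subsingleton N] (i : ℕ) :
    EF A M N i := by
  cases i with
  | zero =>
    rw [ef_zero_iff]
    infer_instance
  | succ i => exact ef_proj M N i

/-- powers of a module -/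
theorem ef_pow [IsNoetherianRing A] (i : ℕ) (h : EF A M N₁ i) (r : ℕ) : EF A M (Fin r → N₁) i := by
  induction r with
  | zero => exact ef_subsingleton M _ i
  | succ r ih =>
    refine ef_mid M (LinearMap.single A (fun _ : Fin (r + 1) => N₁) 0)
      (LinearMap.funLeft A N₁ Fin.succ) ?_ ?_ ?_ i ih h
    · exact Pi.single_injective (M := fun _ : Fin (r + 1) => N₁) 0
    · exact LinearMap.funLeft_surjective_of_injective A N₁ _ (Fin.succ_injective r)
    · intro y
      constructor
      · intro hy
        refine ⟨y 0, ?_⟩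
        ext k
        refine Fin.cases ?_ (fun k => ?_) k
        · simp
        · have := congrFun hy k
          simp only [LinearMap.funLeft_apply] at this
          simp [this]
      · rintro ⟨a, rfl⟩
        ext k
        simp [LinearMap.funLeft_apply]

theorem exists_surj (𝔞 : Ideal A) (N : Type) [AddCommGroup N] [Module A N] [Module.Finite A N]
    (hN : ∀ a ∈ 𝔞, ∀ z : N, a • z = 0) :
    ∃ (r : ℕ) (g : (Fin r → A ⧸ 𝔞) →ₗ[A] N), Function.Surjective g := by
  obtain ⟨r, f, hf⟩ := Module.Finite.exists_fin' A N
  refine ⟨r, ∑ k, (Submodule.liftQ 𝔞 (LinearMap.toSpanSingleton A N (f (Pi.single k 1)))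
        (fun a ha => by simpa using hN a ha _)) ∘ₗ LinearMap.proj k, ?_⟩
  intro z
  obtain ⟨y, rfl⟩ := hf z
  refine ⟨fun k => Submodule.Quotient.mk (y k), ?_⟩
  conv_rhs => rw [← Finset.univ_sum_single y, map_sum]
  rw [LinearMap.sum_apply]
  refine Finset.sum_congr rfl fun k _ => ?_
  rw [LinearMap.comp_apply, LinearMap.proj_apply, Submodule.liftQ_apply,
    LinearMap.toSpanSingleton_apply, ← map_smul, ← Pi.single_smul, smul_eq_mul, mul_one]

/-- Ext finiteness passes from `A/𝔞` to all finite modules killed by `𝔞`. -/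
theorem ef_of_killed [IsNoetherianRing A] (𝔞 : Ideal A) (n : ℕ)
    (h : ∀ i < n, EF A M (A ⧸ 𝔞) i) (i : ℕ) (hi : i < n) :
    ∀ (N : Type) [AddCommGroup N] [Module A N] [Module.Finite A N],
    (∀ a ∈ 𝔞, ∀ z : N, a • z = 0) → EF A M N i := by
  induction i with
  | zero =>
    intro N _ _ _ hN
    obtain ⟨r, g, hg⟩ := exists_surj 𝔞 N hN
    have h0 := (ef_zero_iff M _).1 (ef_pow M 0 (h 0 hi) r)
    rw [ef_zero_iff]
    refine Module.Finite.of_injective (LinearMap.lcomp A M g) ?_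
    intro φ ψ hφ
    ext z
    obtain ⟨y, rfl⟩ := hg z
    exact LinearMap.congr_fun hφ y
  | succ i ih =>
    intro N _ _ _ hN
    obtain ⟨r, g, hg⟩ := exists_surj 𝔞 N hN
    refine ef_right M (LinearMap.ker g).subtype g Subtype.val_injective hg
      (LinearMap.exact_subtype_ker_map g) i ?_ (ef_pow M _ (h _ hi) r)
    refine ih (by omega) _ ?_
    intro a ha z
    ext k
    obtain ⟨b, hb⟩ := Submodule.Quotient.mk_surjective 𝔞 (z.1 k)
    simp only [SetLike.val_smul, Pi.smul_apply, ZeroMemClass.coe_zero, Pi.zero_apply, ← hb]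
    rw [← Submodule.Quotient.mk_smul, Submodule.Quotient.mk_eq_zero]
    exact 𝔞.mul_mem_right b ha

end LES
section Key

variable {C₂ C₁ C₀ : Type} [AddCommGroup C₂] [Module A C₂] [AddCommGroup C₁] [Module A C₁]
  [AddCommGroup C₀] [Module A C₀]

theorem exists_delta [Module.Projective A C₀] (S : Submodule A C₀) :
    ∃ δ : (S →ₗ[A] M) →ₗ[A] Abelian.Ext (ModuleCat.of A (C₀ ⧸ S)) (ModuleCat.of A M) 1,
      Function.Surjective δ ∧ ∀ φ, δ φ = 0 ↔ ∃ ψ : C₀ →ₗ[A] M, ψ ∘ₗ S.subtype = φ := by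
  have hfg : Function.Exact S.subtype S.mkQ := LinearMap.exact_subtype_mkQ S
  have hS := ModuleCat.shortComplex_shortExact
    (ModuleCat.shortComplexOfCompEqZero S.subtype S.mkQ hfg.linearMap_comp_eq_zero) hfg
    Subtype.val_injective S.mkQ_surjective
  have : Projective (ModuleCat.of A C₀) :=
    (IsProjective.iff_projective C₀).1 inferInstance
  let e : Abelian.Ext (ModuleCat.of A S) (ModuleCat.of A M) 0 ≃ₗ[A] (S →ₗ[A] M) :=
    Ext.linearEquiv₀.trans ModuleCat.homLinearEquiv
  let e' : Abelian.Ext (ModuleCat.of A C₀) (ModuleCat.of A M) 0 ≃ₗ[A] (C₀ →ₗ[A] M) :=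
    Ext.linearEquiv₀.trans ModuleCat.homLinearEquiv
  have hcomp : ∀ ψ : C₀ →ₗ[A] M, (Ext.mk₀ (ModuleCat.ofHom S.subtype)).comp (e'.symm ψ)
      (zero_add 0) = e.symm (ψ ∘ₗ S.subtype) := by
    intro ψ
    change (Ext.mk₀ _).comp (Ext.mk₀ (ModuleCat.ofHom ψ)) _ =
      Ext.mk₀ (ModuleCat.ofHom (ψ ∘ₗ S.subtype))
    rw [Ext.mk₀_comp_mk₀, ModuleCat.ofHom_comp]
  refine ⟨(hS.extClass.precompOfLinear A (ModuleCat.of A M) (add_zero 1)) ∘ₗ e.symm.toLinearMap,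
    ?_, ?_⟩
  · intro y
    obtain ⟨x, hx⟩ := Ext.contravariant_sequence_exact₃ hS (ModuleCat.of A M) y
      (Ext.eq_zero_of_projective _) (add_zero 1)
    refine ⟨e x, ?_⟩
    rw [LinearMap.comp_apply, LinearEquiv.coe_coe, e.symm_apply_apply]
    exact hx
  · intro φ
    constructor
    · intro h
      obtain ⟨y, hy⟩ := Ext.contravariant_sequence_exact₁ hS (ModuleCat.of A M) (e.symm φ)
        (add_zero 1) h
      refine ⟨e' y, ?_⟩
      apply e.symm.injective
      rw [← hcomp, e'.symm_apply_apply]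
      exact hy
    · rintro ⟨ψ, rfl⟩
      rw [LinearMap.comp_apply, LinearEquiv.coe_coe, ← hcomp]
      exact hS.extClass_comp_assoc _ (h := add_zero 1)

theorem key [IsNoetherianRing A] [Module.Projective A C₀] (d' : C₂ →ₗ[A] C₁) (d : C₁ →ₗ[A] C₀)
    (hd : d ∘ₗ d' = 0)
    (hH : Module.Finite A
      ((LinearMap.ker d ⧸ (LinearMap.range d').comap (LinearMap.ker d).subtype) →ₗ[A] M)) :
    ((LinearMap.ker (LinearMap.lcomp A M d')).map
      (LinearMap.range (LinearMap.lcomp A M d)).mkQ).FG ↔ EF A M (C₀ ⧸ LinearMap.range d) 1 := by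
  obtain ⟨δ, hδ, hδ0⟩ := exists_delta M (LinearMap.range d)
  set Z := LinearMap.ker (LinearMap.lcomp A M d') with hZ
  set B := LinearMap.range (LinearMap.lcomp A M d) with hB
  let p : (LinearMap.range d →ₗ[A] M) →ₗ[A] ((C₁ →ₗ[A] M) ⧸ B) :=
    B.mkQ ∘ₗ LinearMap.lcomp A M d.rangeRestrict
  have hker : LinearMap.ker p = LinearMap.ker δ := by
    ext φ
    rw [LinearMap.mem_ker, LinearMap.mem_ker, hδ0, LinearMap.comp_apply, Submodule.mkQ_apply,
      Submodule.Quotient.mk_eq_zero, hB, LinearMap.mem_range]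
    refine exists_congr fun ψ => ?_
    constructor
    · intro h
      ext ⟨_, y, rfl⟩
      exact LinearMap.congr_fun h y
    · rintro rfl
      rfl
  have e : LinearMap.range p ≃ₗ[A]
      Abelian.Ext (ModuleCat.of A (C₀ ⧸ LinearMap.range d)) (ModuleCat.of A M) 1 :=
    (p.quotKerEquivRange.symm.trans (Submodule.quotEquivOfEq _ _ hker)).trans
      (δ.quotKerEquivOfSurjective hδ)
  have hEF : (LinearMap.range p).FG ↔ EF A M (C₀ ⧸ LinearMap.range d) 1 := by
    rw [← Module.Finite.iff_fg]
    exact Module.Finite.equiv_iff e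
  rw [← hEF]
  constructor
  · intro h
    refine h.of_le ?_
    rintro _ ⟨φ, rfl⟩
    refine ⟨LinearMap.lcomp A M d.rangeRestrict φ, ?_, rfl⟩
    rw [hZ]
    ext y
    have : d.rangeRestrict (d' y) = 0 := by
      ext
      exact LinearMap.congr_fun hd y
    simp [this]
  · intro h
    let r : (C₁ →ₗ[A] M) →ₗ[A] (LinearMap.ker d →ₗ[A] M) :=
      LinearMap.lcomp A M (LinearMap.ker d).subtype
    have hr : B ≤ LinearMap.ker r := by
      rintro _ ⟨φ, rfl⟩
      ext ⟨y, hy⟩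
      have : d y = 0 := hy
      simp [r, this]
    apply Submodule.fg_of_fg_map_of_fg_inf_ker (B.liftQ r hr)
    · let q := LinearMap.lcomp A M
        ((LinearMap.range d').comap (LinearMap.ker d).subtype).mkQ
      refine Submodule.FG.of_le (T := LinearMap.range q) ?_ ?_
      · rw [LinearMap.range_eq_map]
        exact hH.fg_top.map q
      · rintro _ ⟨_, ⟨φ, hφ, rfl⟩, rfl⟩
        refine ⟨Submodule.liftQ _ (φ ∘ₗ (LinearMap.ker d).subtype) ?_, ?_⟩
        · rintro ⟨y, hy⟩ ⟨w, hw⟩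
          have := LinearMap.congr_fun hφ w
          simp at hw this
          simp [← hw, this]
        · ext y
          simp [q, r]
    · refine h.of_le ?_
      rintro _ ⟨⟨φ, hφ, rfl⟩, hφ'⟩
      have h0 : ∀ y, d y = 0 → φ y = 0 := by
        intro y hy
        exact LinearMap.congr_fun hφ' (⟨y, hy⟩ : LinearMap.ker d)
      have hk : LinearMap.ker d.rangeRestrict ≤ LinearMap.ker φ := by
        intro y hy
        apply h0
        exact congrArg Subtype.val hy
      refine ⟨((LinearMap.ker d.rangeRestrict).liftQ φ hk) ∘ₗ
        (d.rangeRestrict.quotKerEquivOfSurjective d.surjective_rangeRestrict).symm.toLinearMap, ?_⟩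
      change B.mkQ _ = B.mkQ _
      congr 1
      ext y
      have : (d.rangeRestrict.quotKerEquivOfSurjective d.surjective_rangeRestrict).symm
          (d.rangeRestrict y) = Submodule.Quotient.mk y := by
        rw [LinearEquiv.symm_apply_eq]
        rfl
      simp only [LinearMap.lcomp_apply, LinearMap.comp_apply, LinearEquiv.coe_coe]
      rw [this]
      simp

end Key
section Complex

variable (C : ℕ → Type) [∀ i, AddCommGroup (C i)] [∀ i, Module A (C i)]
  (d : ∀ i, C (i + 1) →ₗ[A] C i)

/-- coboundaries of the dual complex -/
def dualBd : (i : ℕ) → Submodule A (C i →ₗ[A] M)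
  | 0 => ⊥
  | i + 1 => LinearMap.range (LinearMap.lcomp A M (d i))

/-- finiteness of the cohomology of the dual complex -/
def CF (i : ℕ) : Prop :=
  ((LinearMap.ker (LinearMap.lcomp A M (d i))).map (dualBd M C d i).mkQ).FG

/-- the homology in degree `i + 1` -/
abbrev Hom1 (i : ℕ) : Type :=
  LinearMap.ker (d i) ⧸ (LinearMap.range (d (i + 1))).comap (LinearMap.ker (d i)).subtype

theorem cf_zero_iff : CF M C d 0 ↔ EF A M (C 0 ⧸ LinearMap.range (d 0)) 0 := by
  rw [ef_zero_iff]
  have h0 : CF M C d 0 ↔ (LinearMap.ker (LinearMap.lcomp A M (d 0))).FG :=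
    Submodule.fg_map_iff (Submodule.mkQ (⊥ : Submodule A (C 0 →ₗ[A] M)))
      (LinearMap.ker_eq_bot.1 (Submodule.ker_mkQ _))
  rw [h0]
  let q := LinearMap.lcomp A M (LinearMap.range (d 0)).mkQ
  have hq : Function.Injective q := by
    intro φ ψ h
    ext y
    exact LinearMap.congr_fun h y
  have hr : LinearMap.range q = LinearMap.ker (LinearMap.lcomp A M (d 0)) := by
    ext φ
    constructor
    · rintro ⟨ψ, rfl⟩
      ext y
      have : (LinearMap.range (d 0)).mkQ (d 0 y) = 0 := by
        rw [Submodule.mkQ_apply, Submodule.Quotient.mk_eq_zero]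
        exact ⟨y, rfl⟩
      change ψ ((LinearMap.range (d 0)).mkQ (d 0 y)) = 0
      rw [this, map_zero]
    · intro h
      refine ⟨Submodule.liftQ _ φ ?_, ?_⟩
      · rintro _ ⟨y, rfl⟩
        exact LinearMap.congr_fun h y
      · ext y
        simp [q]
  rw [← hr, ← Module.Finite.iff_fg]
  exact (Module.Finite.equiv_iff (LinearEquiv.ofInjective q hq)).symm

theorem shift_iff [IsNoetherianRing A] [∀ i, Module.Projective A (C i)]
    (hd : ∀ i, d i ∘ₗ d (i + 1) = 0) (k i : ℕ) (h0 : EF A M (Hom1 C d k) i) (h1 : EF A M (Hom1 C d k) (i + 1)) :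
    EF A M (C (k + 1) ⧸ LinearMap.range (d (k + 1))) (i + 1) ↔
      EF A M (C k ⧸ LinearMap.range (d k)) (i + 1 + 1) := by
  have hB : EF A M (LinearMap.range (d k)) (i + 1) ↔
      EF A M (C k ⧸ LinearMap.range (d k)) (i + 1 + 1) := by
    have hex := LinearMap.exact_subtype_mkQ (LinearMap.range (d k))
    constructor
    · intro h
      exact ef_right M _ _ Subtype.val_injective (Submodule.mkQ_surjective _) hex _ h
        (ef_proj M _ _)
    · intro h
      exact ef_left M _ _ Subtype.val_injective (Submodule.mkQ_surjective _) hex _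
        (ef_proj M _ _) h
  rw [← hB]
  let f : Hom1 C d k →ₗ[A] (C (k + 1) ⧸ LinearMap.range (d (k + 1))) :=
    Submodule.mapQ _ _ (LinearMap.ker (d k)).subtype le_rfl
  let g : (C (k + 1) ⧸ LinearMap.range (d (k + 1))) →ₗ[A] LinearMap.range (d k) :=
    Submodule.liftQ _ (d k).rangeRestrict (by
      rintro _ ⟨y, rfl⟩
      ext
      exact LinearMap.congr_fun (hd k) y)
  have hf : Function.Injective f := by
    rw [← LinearMap.ker_eq_bot, LinearMap.ker_eq_bot']
    intro y hy
    obtain ⟨y, rfl⟩ := Submodule.Quotient.mk_surjective _ y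
    rw [Submodule.mapQ_apply, Submodule.Quotient.mk_eq_zero] at hy
    rw [Submodule.Quotient.mk_eq_zero]
    exact hy
  have hg : Function.Surjective g := by
    rintro ⟨_, y, rfl⟩
    exact ⟨Submodule.Quotient.mk y, rfl⟩
  have hfg : Function.Exact f g := by
    intro y
    constructor
    · intro hy
      obtain ⟨y, rfl⟩ := Submodule.Quotient.mk_surjective _ y
      have hy' : d k y = 0 := congrArg Subtype.val hy
      exact ⟨Submodule.Quotient.mk ⟨y, hy'⟩, rfl⟩
    · rintro ⟨z, rfl⟩
      obtain ⟨z, rfl⟩ := Submodule.Quotient.mk_surjective _ z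
      ext
      exact z.2
  constructor
  · intro h
    exact ef_right M f g hf hg hfg _ h0 h
  · intro h
    exact ef_mid M f g hf hg hfg _ h h1

theorem hom1_killed (𝔞 : Ideal A)
    (hkill : ∀ i, ∀ a ∈ 𝔞, ∀ z, d i z = 0 → ∃ y, d (i + 1) y = a • z)
    (k : ℕ) (a : A) (ha : a ∈ 𝔞) (z : Hom1 C d k) : a • z = 0 := by
  obtain ⟨z, rfl⟩ := Submodule.Quotient.mk_surjective _ z
  rw [← Submodule.Quotient.mk_smul, Submodule.Quotient.mk_eq_zero]
  exact hkill k a ha z.1 z.2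

theorem shift_all [IsNoetherianRing A] [∀ i, Module.Projective A (C i)]
    (hd : ∀ i, d i ∘ₗ d (i + 1) = 0) (𝔞 : Ideal A)
    (e : (C 0 ⧸ LinearMap.range (d 0)) ≃ₗ[A] A ⧸ 𝔞)
    (hfin : ∀ i, Module.Finite A (Hom1 C d i))
    (hkill : ∀ i, ∀ a ∈ 𝔞, ∀ z, d i z = 0 → ∃ y, d (i + 1) y = a • z)
    (n : ℕ) (h : ∀ i < n, EF A M (A ⧸ 𝔞) i) (k i : ℕ) (hk : k + i + 1 ≤ n) :
    EF A M (C k ⧸ LinearMap.range (d k)) (i + 1) ↔ EF A M (A ⧸ 𝔞) (k + i + 1) := by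
  induction k generalizing i with
  | zero =>
    rw [show 0 + i + 1 = i + 1 by omega]
    exact ⟨ef_equiv M e _, ef_equiv M e.symm _⟩
  | succ k ih =>
    have hj : ∀ j < n, EF A M (Hom1 C d k) j := fun j hj =>
      have := hfin k
      ef_of_killed M 𝔞 n h j hj (Hom1 C d k) (hom1_killed C d 𝔞 hkill k)
    rw [shift_iff M C d hd k i (hj _ (by omega)) (hj _ (by omega)), ih (i + 1) (by omega)]
    rw [show k + (i + 1) + 1 = k + 1 + i + 1 by omega]

theorem cf_step [IsNoetherianRing A] [∀ i, Module.Projective A (C i)]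
    (hd : ∀ i, d i ∘ₗ d (i + 1) = 0) (𝔞 : Ideal A)
    (e : (C 0 ⧸ LinearMap.range (d 0)) ≃ₗ[A] A ⧸ 𝔞)
    (hfin : ∀ i, Module.Finite A (Hom1 C d i))
    (hkill : ∀ i, ∀ a ∈ 𝔞, ∀ z, d i z = 0 → ∃ y, d (i + 1) y = a • z)
    (n : ℕ) (h : ∀ i < n, EF A M (A ⧸ 𝔞) i) :
    CF M C d n ↔ EF A M (A ⧸ 𝔞) n := by
  cases n with
  | zero =>
    rw [cf_zero_iff]
    exact ⟨ef_equiv M e _, ef_equiv M e.symm _⟩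
  | succ m =>
    rw [show EF A M (A ⧸ 𝔞) (m + 1) ↔ EF A M (A ⧸ 𝔞) (m + 0 + 1) from Iff.rfl,
      ← shift_all M C d hd 𝔞 e hfin hkill (m + 1) h m 0 le_rfl]
    refine key M (d (m + 1)) (d m) (hd m) ?_
    have := hfin m
    exact (ef_zero_iff M _).1 (ef_of_killed M 𝔞 (m + 1) h 0 (by omega) (Hom1 C d m)
      (hom1_killed C d 𝔞 hkill m))

theorem cf_all [IsNoetherianRing A] [∀ i, Module.Projective A (C i)]
    (hd : ∀ i, d i ∘ₗ d (i + 1) = 0) (𝔞 : Ideal A)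
    (e : (C 0 ⧸ LinearMap.range (d 0)) ≃ₗ[A] A ⧸ 𝔞)
    (hfin : ∀ i, Module.Finite A (Hom1 C d i))
    (hkill : ∀ i, ∀ a ∈ 𝔞, ∀ z, d i z = 0 → ∃ y, d (i + 1) y = a • z)
    (n : ℕ) :
    (∀ i ≤ n, CF M C d i) ↔ (∀ i ≤ n, EF A M (A ⧸ 𝔞) i) := by
  constructor
  · intro h i
    induction i using Nat.strong_induction_on with
    | _ i ih =>
      intro hi
      exact (cf_step M C d hd 𝔞 e hfin hkill i fun j hj => ih j hj (by omega)).1 (h i hi)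
  · intro h i hi
    exact (cf_step M C d hd 𝔞 e hfin hkill i fun j hj => h j (by omega)).2 (h i hi)

end Complex

/-- cohomology as a subquotient -/
theorem finite_subquot_iff {Y : Type} [AddCommGroup Y] [Module A Y] (Z B : Submodule A Y) :
    Module.Finite A (Z ⧸ B.comap Z.subtype) ↔ (Z.map B.mkQ).FG := by
  have h : LinearMap.ker (B.mkQ ∘ₗ Z.subtype) = B.comap Z.subtype := by
    rw [LinearMap.ker_comp, Submodule.ker_mkQ]
  have h2 : LinearMap.range (B.mkQ ∘ₗ Z.subtype) = Z.map B.mkQ := by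
    rw [LinearMap.range_comp, Submodule.range_subtype]
  rw [← h, ← h2, ← Module.Finite.iff_fg]
  exact Module.Finite.equiv_iff (LinearMap.quotKerEquivRange _)

theorem subquot_transfer {Y Y' : Type} [AddCommGroup Y] [Module A Y] [AddCommGroup Y'] [Module A Y']
    (e : Y ≃ₗ[A] Y') (Z B : Submodule A Y) (Z' B' : Submodule A Y')
    (hZ : ∀ y, y ∈ Z ↔ e y ∈ Z') (hB : ∀ y, y ∈ B ↔ e y ∈ B') :
    (Z.map B.mkQ).FG ↔ (Z'.map B'.mkQ).FG := by
  have hB' : B.map e.toLinearMap = B' := by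
    ext y
    constructor
    · rintro ⟨x, hx, rfl⟩
      exact (hB x).1 hx
    · intro hy
      exact ⟨e.symm y, (hB _).2 (by simpa using hy), by simp⟩
  let E := Submodule.Quotient.equiv B B' e hB'
  have : Z'.map B'.mkQ = (Z.map B.mkQ).map E.toLinearMap := by
    ext y
    constructor
    · rintro ⟨x, hx, rfl⟩
      refine ⟨_, ⟨e.symm x, (hZ _).2 (by simpa using hx), rfl⟩, ?_⟩
      simp [E]
    · rintro ⟨_, ⟨x, hx, rfl⟩, rfl⟩
      exact ⟨e x, (hZ x).1 hx, by simp [E]⟩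
  rw [this]
  exact (Submodule.fg_map_iff E.toLinearMap E.injective).symm


theorem finite_homology_iff (S : ShortComplex (ModuleCat.{0} A)) :
    Module.Finite A S.homology ↔
      ((LinearMap.ker S.g.hom).map (LinearMap.range S.f.hom).mkQ).FG := by
  rw [← finite_subquot_iff]
  rw [Module.Finite.equiv_iff S.moduleCatHomologyIso.toLinearEquiv]
  have : LinearMap.range S.moduleCatToCycles =
      (LinearMap.range S.f.hom).comap (LinearMap.ker S.g.hom).subtype :=
    LinearMap.range_codRestrict _ _ _
  exact Module.Finite.equiv_iff (Submodule.quotEquivOfEq _ _ this)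

theorem ext_iff_cf (P : ChainComplex (ModuleCat A) ℕ) (i : ℕ) :
    Module.Finite A ((P.linearYonedaObj A (ModuleCat.of A M)).homology i) ↔
      CF M (fun i => P.X i) (fun i => (P.d (i + 1) i).hom) i := by
  let K := P.linearYonedaObj A (ModuleCat.of A M)
  have hd : ∀ (j : ℕ) (φ : P.X i ⟶ ModuleCat.of A M),
      (K.d i j).hom φ = P.d j i ≫ φ := fun j φ => rfl
  have hd' : ∀ (j : ℕ) (φ : P.X j ⟶ ModuleCat.of A M),
      (K.d j i).hom φ = P.d i j ≫ φ := fun j φ => rfl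
  have key : ∀ j, (∀ φ : P.X i ⟶ ModuleCat.of A M,
      φ ∈ LinearMap.range (K.d j i).hom ↔
        φ.hom ∈ dualBd M (fun i => P.X i) (fun i => (P.d (i + 1) i).hom) i) →
      (Module.Finite A (K.sc' j i (i + 1)).homology ↔
      CF M (fun i => P.X i) (fun i => (P.d (i + 1) i).hom) i) := by
    intro j hj
    rw [finite_homology_iff]
    refine subquot_transfer (ModuleCat.homLinearEquiv (S := A) (M := P.X i)
      (N := ModuleCat.of A M)) _ _ _ _ ?_ hj
    intro φ
    change P.d (i + 1) i ≫ φ = 0 ↔ φ.hom ∘ₗ (P.d (i + 1) i).hom = 0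
    rw [← ModuleCat.hom_comp, ModuleCat.hom_ext_iff]
    rfl
  cases i with
  | zero =>
    have e1 : K.homology 0 ≅ (K.sc' 0 0 1).homology :=
      ShortComplex.homologyMapIso (K.isoSc' 0 0 1 (by simp) (by simp))
    rw [← key 0]
    · exact Module.Finite.equiv_iff e1.toLinearEquiv
    · intro φ
      rw [K.shape 0 0 (by simp)]
      constructor
      · rintro ⟨ψ, rfl⟩
        exact Submodule.zero_mem _
      · intro h
        have h0 : φ.hom = 0 := h
        exact ⟨0, (ModuleCat.hom_ext h0).symm⟩
  | succ i =>
    have e1 : K.homology (i + 1) ≅ (K.sc' i (i + 1) (i + 1 + 1)).homology :=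
      ShortComplex.homologyMapIso (K.isoSc' i (i + 1) (i + 1 + 1) (by simp) (by simp))
    rw [← key i]
    · exact Module.Finite.equiv_iff e1.toLinearEquiv
    · intro φ
      constructor
      · rintro ⟨ψ, rfl⟩
        exact ⟨ModuleCat.Hom.hom (show P.X i ⟶ ModuleCat.of A M from ψ), rfl⟩
      · rintro ⟨ψ, hψ⟩
        refine ⟨(ModuleCat.ofHom ψ : P.X i ⟶ ModuleCat.of A M), ?_⟩
        rw [hd']
        apply ModuleCat.hom_ext
        exact hψ

theorem ext_iff_ef [IsNoetherianRing A] (𝔞 : Ideal A) (n : ℕ) :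
    (∀ i ≤ n, Module.Finite A (extQuot 𝔞 M i)) ↔ (∀ i ≤ n, EF A M (A ⧸ 𝔞) i) := by
  let P := projectiveResolution (ModuleCat.of A (A ⧸ 𝔞))
  have h1 : ∀ i, Module.Finite A (extQuot 𝔞 M i) ↔
      CF M (fun i => P.complex.X i) (fun i => (P.complex.d (i + 1) i).hom) i := fun i => by
    rw [← ext_iff_cf]
    exact Module.Finite.equiv_iff (P.isoExt (R := A) i (ModuleCat.of A M)).toLinearEquiv
  simp only [h1]
  have hproj : ∀ i, Module.Projective A (P.complex.X i) := fun i =>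
    (IsProjective.iff_projective _).2 (P.projective i)
  have hex : ∀ i z, (P.complex.d (i + 1) i).hom z = 0 →
      ∃ y, (P.complex.d (i + 1 + 1) (i + 1)).hom y = z := fun i =>
    (ShortComplex.moduleCat_exact_iff _).1 (P.exact_succ i)
  let π : P.complex.X 0 →ₗ[A] (A ⧸ 𝔞) := (P.π.f 0).hom
  have hπ : Function.Surjective π := (ModuleCat.epi_iff_surjective (P.π.f 0)).1 inferInstance
  have hker : LinearMap.range (P.complex.d 1 0).hom = LinearMap.ker π :=
    P.exact₀.moduleCat_range_eq_ker
  refine cf_all M (fun i => P.complex.X i) (fun i => (P.complex.d (i + 1) i).hom) ?_ 𝔞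
    ((Submodule.quotEquivOfEq _ _ hker).trans (π.quotKerEquivOfSurjective hπ)) ?_ ?_ n
  · intro i
    rw [← ModuleCat.hom_comp, P.complex.d_comp_d]
    rfl
  · intro i
    have : Subsingleton (Hom1 (fun i => P.complex.X i) (fun i => (P.complex.d (i + 1) i).hom) i) := by
      refine subsingleton_of_forall_eq 0 fun z => ?_
      obtain ⟨⟨z, hz⟩, rfl⟩ := Submodule.Quotient.mk_surjective _ z
      rw [Submodule.Quotient.mk_eq_zero]
      exact hex i z hz
    infer_instance
  · intro i a _ z hz
    exact hex i _ (by rw [map_smul, hz, smul_zero])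

end GeneralPart

section KoszulPart

variable {t : ℕ}

variable (A) in
/-- sign -/
def ksgn (j : Fin t) (s : Finset (Fin t)) : A := (-1 : A) ^ ((s.filter (fun k => k < j)).card)

theorem ksgn_insert_of_lt {j k : Fin t} {s : Finset (Fin t)} (hj : j ∉ s) (h : j < k) :
    ksgn A k (insert j s) = - ksgn A k s := by
  unfold ksgn
  rw [Finset.filter_insert, if_pos h, Finset.card_insert_of_notMem (by simp [hj]), pow_succ]
  ring

theorem ksgn_insert_of_le {j k : Fin t} {s : Finset (Fin t)} (h : k ≤ j) :
    ksgn A k (insert j s) = ksgn A k s := by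
  unfold ksgn
  rw [Finset.filter_insert, if_neg (not_lt.2 h)]

theorem ksgn_erase_of_lt {j k : Fin t} {s : Finset (Fin t)} (hj : j ∈ s) (h : j < k) :
    ksgn A k (s.erase j) = - ksgn A k s := by
  have := ksgn_insert_of_lt (A := A) (Finset.notMem_erase j s) h
  rw [Finset.insert_erase hj] at this
  rw [this, neg_neg]

theorem ksgn_erase_of_le {j k : Fin t} {s : Finset (Fin t)} (h : k ≤ j) :
    ksgn A k (s.erase j) = ksgn A k s := by
  by_cases hj : j ∈ s
  · have := ksgn_insert_of_le (A := A) (s := s.erase j) h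
    rw [Finset.insert_erase hj] at this
    rw [this]
  · rw [Finset.erase_eq_of_notMem hj]

theorem ksgn_mul_self (j : Fin t) (s : Finset (Fin t)) : ksgn A j s * ksgn A j s = 1 := by
  unfold ksgn
  rw [← mul_pow]
  simp

/-- annihilation operator -/
def kann (j : Fin t) : (Finset (Fin t) →₀ A) →ₗ[A] (Finset (Fin t) →₀ A) :=
  Finsupp.linearCombination A
    (fun s => if j ∈ s then Finsupp.single (s.erase j) (ksgn A j s) else 0)

/-- creation operator -/
def kcre (j : Fin t) : (Finset (Fin t) →₀ A) →ₗ[A] (Finset (Fin t) →₀ A) :=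
  Finsupp.linearCombination A
    (fun s => if j ∈ s then 0 else Finsupp.single (insert j s) (ksgn A j s))

theorem kann_mem {j : Fin t} {s : Finset (Fin t)} (h : j ∈ s) (c : A) :
    kann j (Finsupp.single s c) = Finsupp.single (s.erase j) (c * ksgn A j s) := by
  simp [kann, h]

theorem kann_notMem {j : Fin t} {s : Finset (Fin t)} (h : j ∉ s) (c : A) :
    kann j (Finsupp.single s c) = 0 := by
  simp [kann, h]

theorem kcre_mem {j : Fin t} {s : Finset (Fin t)} (h : j ∈ s) (c : A) :
    kcre j (Finsupp.single s c) = 0 := by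
  simp [kcre, h]

theorem kcre_notMem {j : Fin t} {s : Finset (Fin t)} (h : j ∉ s) (c : A) :
    kcre j (Finsupp.single s c) = Finsupp.single (insert j s) (c * ksgn A j s) := by
  simp [kcre, h]

theorem kann_kann_self (j : Fin t) (z : Finset (Fin t) →₀ A) : kann j (kann j z) = 0 := by
  induction z using Finsupp.induction_linear with
  | zero => simp
  | add f g hf hg => simp [hf, hg]
  | single s c =>
    by_cases h : j ∈ s
    · rw [kann_mem h, kann_notMem (by simp)]
    · rw [kann_notMem h, map_zero]

theorem kann_kann_of_lt {j k : Fin t} (hjk : j < k) (z : Finset (Fin t) →₀ A) :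
    kann j (kann k z) + kann k (kann j z) = 0 := by
  induction z using Finsupp.induction_linear with
  | zero => simp
  | add f g hf hg =>
    simp only [map_add]
    rw [add_add_add_comm, hf, hg, add_zero]
  | single s c =>
    by_cases h : j ∈ s
    · by_cases h' : k ∈ s
      · rw [kann_mem h, kann_mem h', kann_mem (by simp [h, hjk.ne]), kann_mem (by simp [h', hjk.ne']),
          ksgn_erase_of_le hjk.le, ksgn_erase_of_lt h hjk, Finset.erase_right_comm, ← Finsupp.single_add]
        rw [show c * ksgn A k s * ksgn A j s + c * ksgn A j s * -ksgn A k s = 0 by ring,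
          Finsupp.single_zero]
      · rw [kann_notMem h', kann_mem h, kann_notMem (by simp [h'])]; simp
    · rw [kann_notMem h]
      by_cases h' : k ∈ s
      · rw [kann_mem h', kann_notMem (by simp [h])]; simp
      · rw [kann_notMem h']; simp

theorem kann_kann_of_ne {j k : Fin t} (hjk : j ≠ k) (z : Finset (Fin t) →₀ A) :
    kann j (kann k z) + kann k (kann j z) = 0 := by
  rcases lt_or_gt_of_ne hjk with h | h
  · exact kann_kann_of_lt h z
  · rw [add_comm]; exact kann_kann_of_lt h z

theorem kann_kcre_self (j : Fin t) (z : Finset (Fin t) →₀ A) :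
    kann j (kcre j z) + kcre j (kann j z) = z := by
  induction z using Finsupp.induction_linear with
  | zero => simp
  | add f g hf hg =>
    simp only [map_add]
    rw [add_add_add_comm, hf, hg]
  | single s c =>
    by_cases h : j ∈ s
    · rw [kcre_mem h, kann_mem h, kcre_notMem (by simp), ksgn_erase_of_le le_rfl, mul_assoc,
        ksgn_mul_self, Finset.insert_erase h]
      simp
    · rw [kcre_notMem h, kann_notMem h, kann_mem (by simp), ksgn_insert_of_le le_rfl, mul_assoc,
        ksgn_mul_self, Finset.erase_insert h]
      simp

theorem kann_kcre_of_ne {j k : Fin t} (hjk : k ≠ j) (z : Finset (Fin t) →₀ A) :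
    kann k (kcre j z) + kcre j (kann k z) = 0 := by
  induction z using Finsupp.induction_linear with
  | zero => simp
  | add f g hf hg =>
    simp only [map_add]
    rw [add_add_add_comm, hf, hg, add_zero]
  | single s c =>
    by_cases h : j ∈ s
    · rw [kcre_mem h]
      by_cases h' : k ∈ s
      · rw [kann_mem h', kcre_mem (by simp [h, hjk.symm])]; simp
      · rw [kann_notMem h']; simp
    · rw [kcre_notMem h]
      by_cases h' : k ∈ s
      · rw [kann_mem h', kann_mem (by simp [h']), kcre_notMem (by simp [h]),
          Finset.erase_insert_of_ne hjk.symm, ← Finsupp.single_add]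
        rcases lt_or_gt_of_ne hjk with hlt | hlt
        · rw [ksgn_insert_of_le hlt.le, ksgn_erase_of_lt h' hlt]
          rw [show c * ksgn A j s * ksgn A k s + c * ksgn A k s * -ksgn A j s = 0 by ring,
            Finsupp.single_zero]
        · rw [ksgn_insert_of_lt h hlt, ksgn_erase_of_le hlt.le]
          rw [show c * ksgn A j s * -ksgn A k s + c * ksgn A k s * ksgn A j s = 0 by ring,
            Finsupp.single_zero]
      · rw [kann_notMem h', kann_notMem (by simp [h', hjk])]; simp

/-- total differential -/
def kD (x : Fin t → A) : (Finset (Fin t) →₀ A) →ₗ[A] (Finset (Fin t) →₀ A) :=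
  ∑ j, x j • kann j

theorem kD_apply (x : Fin t → A) (z : Finset (Fin t) →₀ A) : kD x z = ∑ j, x j • kann j z := by
  simp [kD, LinearMap.sum_apply]

theorem kD_kD (x : Fin t → A) (z : Finset (Fin t) →₀ A) : kD x (kD x z) = 0 := by
  simp only [kD_apply, map_sum, map_smul, Finset.smul_sum]
  rw [← Finset.sum_product', ]
  refine Finset.sum_involution (fun p _ => (p.2, p.1)) ?_ ?_ ?_ ?_
  · rintro ⟨j, k⟩ -
    by_cases h : j = k
    · subst h
      simp [kann_kann_self]
    · simp only
      rw [smul_comm (x k) (x j), ← smul_add, ← smul_add, kann_kann_of_ne (Ne.symm h), smul_zero, smul_zero]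
  · rintro ⟨j, k⟩ - hne heq
    simp only [Prod.mk.injEq] at heq
    obtain ⟨rfl, -⟩ := heq
    apply hne
    simp [kann_kann_self]
  · simp
  · simp

theorem kD_kcre (x : Fin t → A) (j : Fin t) (z : Finset (Fin t) →₀ A) :
    kD x (kcre j z) + kcre j (kD x z) = x j • z := by
  simp only [kD_apply, map_sum, map_smul]
  rw [← Finset.sum_add_distrib, Finset.sum_eq_single j]
  · rw [← smul_add, kann_kcre_self]
  · intro k _ hk
    rw [← smul_add, kann_kcre_of_ne hk, smul_zero]
  · simp

/-- graded piece of the Koszul chain complex -/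
abbrev KCh (A : Type) [CommRing A] (t : ℕ) (i : ℕ) : Type :=
  {s : Finset (Fin t) // s.card = i} →₀ A

/-- inclusion of graded piece -/
def kincl (i : ℕ) : KCh A t i →ₗ[A] (Finset (Fin t) →₀ A) :=
  Finsupp.lmapDomain A A Subtype.val

theorem kincl_injective (i : ℕ) : Function.Injective (kincl (A := A) (t := t) i) :=
  Finsupp.mapDomain_injective Subtype.val_injective

@[simp] theorem kincl_single (i : ℕ) (s : {s : Finset (Fin t) // s.card = i}) (c : A) :
    kincl i (Finsupp.single s c) = Finsupp.single s.1 c := by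
  simp [kincl]

/-- Koszul chain differential -/
def kd (x : Fin t → A) (i : ℕ) : KCh A t (i + 1) →ₗ[A] KCh A t i :=
  Finsupp.linearCombination A (fun s => ∑ j ∈ s.1.attach,
    (((-1 : A) ^ ((s.1.filter (fun k => k < j.1)).card)) * x j.1) •
      Finsupp.single (⟨s.1.erase j.1, by simp [Finset.card_erase_of_mem j.2, s.2]⟩ :
          {s : Finset (Fin t) // s.card = i}) (1 : A))

/-- Koszul homotopy -/
def kh (j : Fin t) (i : ℕ) : KCh A t i →ₗ[A] KCh A t (i + 1) :=
  Finsupp.linearCombination A (fun s => if h : j ∈ s.1 then 0 else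
      Finsupp.single (⟨insert j s.1, by simp [Finset.card_insert_of_notMem h, s.2]⟩ :
          {s : Finset (Fin t) // s.card = i + 1}) (ksgn A j s.1))

theorem kincl_kd (x : Fin t → A) (i : ℕ) (z : KCh A t (i + 1)) :
    kincl i (kd x i z) = kD x (kincl (i + 1) z) := by
  induction z using Finsupp.induction_linear with
  | zero => simp
  | add f g hf hg => simp only [map_add, hf, hg]
  | single s c =>
    rw [kincl_single, kD_apply, ← Finset.sum_subset (Finset.subset_univ s.1), ← Finset.sum_attach s.1]
    · simp only [kd, Finsupp.linearCombination_single, map_smul, map_sum, kincl_single, Finset.smul_sum]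
      refine Finset.sum_congr rfl fun j _ => ?_
      rw [kann_mem j.2]
      simp only [Finsupp.smul_single, smul_eq_mul, ksgn]
      congr 1
      ring
    · intro j _ hj
      rw [kann_notMem hj, smul_zero]

theorem kincl_kh (j : Fin t) (i : ℕ) (z : KCh A t i) :
    kincl (i + 1) (kh j i z) = kcre j (kincl i z) := by
  induction z using Finsupp.induction_linear with
  | zero => simp
  | add f g hf hg => simp only [map_add, hf, hg]
  | single s c =>
    rw [kincl_single]
    by_cases h : j ∈ s.1
    · rw [kcre_mem h]
      simp [kh, h]
    · rw [kcre_notMem h]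
      simp only [kh, Finsupp.linearCombination_single, dif_neg h, map_smul, kincl_single,
        Finsupp.smul_single, smul_eq_mul]

theorem kd_kd (x : Fin t → A) (i : ℕ) : kd x i ∘ₗ kd x (i + 1) = 0 := by
  apply LinearMap.ext
  intro z
  apply kincl_injective
  rw [LinearMap.comp_apply, kincl_kd, kincl_kd, kD_kD]
  simp

theorem kd_kill (x : Fin t → A) (i : ℕ) (a : A) (ha : a ∈ Ideal.span (Set.range x))
    (z : KCh A t (i + 1)) (hz : kd x i z = 0) : ∃ y, kd x (i + 1) y = a • z := by
  have : Ideal.span (Set.range x) ≤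
      (LinearMap.range (kd x (i + 1))).comap (LinearMap.toSpanSingleton A _ z) := by
    rw [Ideal.span, Submodule.span_le]
    rintro _ ⟨j, rfl⟩
    refine ⟨kh j (i + 1) z, ?_⟩
    apply kincl_injective
    have h := kD_kcre x j (kincl (i + 1) z)
    rw [← kincl_kd, hz, map_zero, map_zero, add_zero] at h
    rw [kincl_kd, kincl_kh, h]
    simp
  exact this ha

theorem card_zero_eq (s : {s : Finset (Fin t) // s.card = 0}) : s = ⟨∅, rfl⟩ :=
  Subtype.ext (Finset.card_eq_zero.1 s.2)

instance : Unique {s : Finset (Fin t) // s.card = 0} where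
  default := ⟨∅, rfl⟩
  uniq := card_zero_eq

/-- degree zero homology -/
theorem kd_zero (x : Fin t → A) :
    Nonempty ((KCh A t 0 ⧸ LinearMap.range (kd x 0)) ≃ₗ[A] A ⧸ Ideal.span (Set.range x)) := by
  let u : KCh A t 0 ≃ₗ[A] A := Finsupp.LinearEquiv.finsuppUnique A A _
  have hu : ∀ s c, u (Finsupp.single s c) = c := by
    intro s c
    rw [card_zero_eq s]
    exact Finsupp.single_eq_same
  refine ⟨Submodule.Quotient.equiv _ _ u ?_⟩
  apply le_antisymm
  · rintro _ ⟨_, ⟨z, rfl⟩, rfl⟩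
    induction z using Finsupp.induction_linear with
    | zero => simp
    | add f g hf hg => simp only [map_add]; exact Submodule.add_mem _ hf hg
    | single s c =>
      simp only [kd, Finsupp.linearCombination_single, map_smul, map_sum]
      refine Submodule.smul_mem _ _ (Submodule.sum_mem _ fun j _ => ?_)
      rw [LinearEquiv.coe_coe, hu, smul_eq_mul, mul_one]
      exact Ideal.mul_mem_left _ _ (Ideal.subset_span ⟨_, rfl⟩)
  · rw [Ideal.span, Submodule.span_le]
    rintro _ ⟨j, rfl⟩
    refine ⟨_, ⟨Finsupp.single ⟨{j}, by simp⟩ 1, rfl⟩, ?_⟩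
    simp only [kd, Finsupp.linearCombination_single, map_smul, map_sum, LinearEquiv.coe_coe, hu]
    rw [Finset.sum_attach {j} (fun k => ((-1 : A) ^ ((({j} : Finset (Fin t)).filter
      (fun l => l < k)).card) * x k) • (1 : A))]
    simp [Finset.filter_singleton]

variable (M : Type) [AddCommGroup M] [Module A M]

/-- comparison -/
def kcmp (i : ℕ) : (KCh A t i →ₗ[A] M) ≃ₗ[A] ({s : Finset (Fin t) // s.card = i} → M) :=
  (Finsupp.llift M A A _).symm

theorem kcmp_apply (i : ℕ) (φ : KCh A t i →ₗ[A] M) (s) :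
    kcmp M i φ s = φ (Finsupp.single s 1) := rfl

theorem koszulD_kcmp (x : Fin t → A) (i : ℕ) (φ : KCh A t i →ₗ[A] M) :
    koszulD x M i (kcmp M i φ) = kcmp M (i + 1) (φ ∘ₗ kd x i) := by
  ext s
  rw [kcmp_apply, LinearMap.comp_apply]
  simp only [koszulD, kd, Finsupp.linearCombination_single, one_smul, map_sum, map_smul,
    LinearMap.pi_apply, LinearMap.sum_apply, LinearMap.smul_apply, LinearMap.proj_apply, kcmp_apply]

theorem koszul_iff_cf (x : Fin t → A) (i : ℕ) :
    Module.Finite A (KoszulCohomology x M i) ↔ CF M (KCh A t) (kd x) i := by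
  rw [finite_subquot_iff]
  unfold CF
  symm
  refine subquot_transfer (kcmp M i) _ _ _ _ ?_ ?_
  · intro φ
    rw [LinearMap.mem_ker, LinearMap.mem_ker, koszulD_kcmp, LinearEquiv.map_eq_zero_iff]
    rfl
  · intro φ
    cases i with
    | zero =>
      change φ = 0 ↔ (kcmp (A := A) (t := t) M 0) φ = 0
      exact (LinearEquiv.map_eq_zero_iff (kcmp (A := A) M 0)).symm
    | succ i =>
      change φ ∈ LinearMap.range _ ↔ _ ∈ LinearMap.range _
      constructor
      · rintro ⟨ψ, rfl⟩
        exact ⟨kcmp (A := A) M i ψ, koszulD_kcmp M x i ψ⟩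
      · rintro ⟨ψ, hψ⟩
        obtain ⟨ψ, rfl⟩ := (kcmp (A := A) M i).surjective ψ
        rw [koszulD_kcmp] at hψ
        exact ⟨ψ, (kcmp (A := A) M (i + 1)).injective hψ⟩

theorem koszul_iff_ef [IsNoetherianRing A] (x : Fin t → A) (n : ℕ) :
    (∀ i ≤ n, Module.Finite A (KoszulCohomology x M i)) ↔
      (∀ i ≤ n, EF A M (A ⧸ Ideal.span (Set.range x)) i) := by
  simp only [koszul_iff_cf]
  obtain ⟨e⟩ := kd_zero x
  exact cf_all M (KCh A t) (kd x) (kd_kd x) _ e (fun i => inferInstance) (kd_kill x) n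

end KoszulPart

/-- If `𝔞 = (x₁, …, x_t)`, then `Ext_A^i(A/𝔞, M)` is finitely generated for all `i ≤ n`
iff the Koszul cohomology `H^i(x, M)` is finitely generated for all `i ≤ n`. -/
theorem stmt8 [IsNoetherianRing A] (𝔞 : Ideal A) {t : ℕ} (x : Fin t → A)
    (hgen : 𝔞 = Ideal.span (Set.range x))
    (M : Type) [AddCommGroup M] [Module A M] (n : ℕ) :
    (∀ i ≤ n, Module.Finite A (extQuot 𝔞 M i)) ↔
      (∀ i ≤ n, Module.Finite A (KoszulCohomology x M i)) := by
  subst hgen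
  rw [ext_iff_ef, koszul_iff_ef]

end
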